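/- Let q = 1/1.409. There do not exist 11 points in the plane with pairwise distances at least q such that all lie in the annulus 1 ≤ |P| ≤ 1.45, at least 10 of them lie in 1 ≤ |P| ≤ 1.24, and at least 9 of them lie in 1 ≤ |P| ≤ 1.19. -/

import Mathlib

/-- A lower bound for the cosine: `1 - y ^ 2 / 2 ≤ cos y` at `y = x / 8`, followed by three
angle doublings. -/
theorem Real.two_mul_sq_sub_one_iterate_le_cos (x : ℝ) (hx : |x| ≤ 1) :
    2 * (2 * (2 * (1 - (x / 8) ^ 2 / 2) ^ 2 - 1) ^ 2 - 1) ^ 2 - 1 ≤ Real.cos x := by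
  obtain ⟨hl, hu⟩ := abs_le.mp hx
  have h8 := Real.one_sub_sq_div_two_le_cos (x := x / 8)
  have e4 : Real.cos (x / 4) = 2 * Real.cos (x / 8) ^ 2 - 1 := by
    rw [← Real.cos_two_mul]; ring_nf
  have e2 : Real.cos (x / 2) = 2 * Real.cos (x / 4) ^ 2 - 1 := by
    rw [← Real.cos_two_mul]; ring_nf
  have e1 : Real.cos x = 2 * Real.cos (x / 2) ^ 2 - 1 := by
    rw [← Real.cos_two_mul]; ring_nf
  have hx2 : x ^ 2 ≤ 1 := by nlinarith
  have p8 : 127 / 128 ≤ 1 - (x / 8) ^ 2 / 2 := by linarith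
  set u := 1 - (x / 8) ^ 2 / 2
  have p4 : 24 / 25 ≤ 2 * u ^ 2 - 1 := by nlinarith
  have h4 : 2 * u ^ 2 - 1 ≤ Real.cos (x / 4) := by
    rw [e4]; gcongr
  set v := 2 * u ^ 2 - 1
  have p2 : 0 ≤ 2 * v ^ 2 - 1 := by nlinarith
  have h2 : 2 * v ^ 2 - 1 ≤ Real.cos (x / 2) := by
    rw [e2]; gcongr
  rw [e1]; gcongr

/-- The law of cosines bounds the cosine of the angle between two points of the annulus
`1 ≤ |P| ≤ R` at mutual distance at least `d`. -/
theorem cos_le_of_annulus {a b R K d c : ℝ} (ha : 1 ≤ a) (haR : a ≤ R) (hb : 1 ≤ b) (hbR : b ≤ R)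
    (hd : d ^ 2 ≤ a ^ 2 + b ^ 2 - 2 * a * b * c)
    (h11 : 2 - d ^ 2 ≤ 2 * K) (h1R : 1 + R ^ 2 - d ^ 2 ≤ 2 * R * K)
    (hRR : 2 * R ^ 2 - d ^ 2 ≤ 2 * R ^ 2 * K) : c ≤ K := by
  have hab : 0 < a * b := by positivity
  have key : a ^ 2 + b ^ 2 - d ^ 2 ≤ 2 * (a * b) * K := by
    rcases haR.eq_or_lt with rfl | haR'
    · rcases ha.eq_or_lt with rfl | ha'
      · obtain rfl : b = 1 := le_antisymm hbR hb
        linarith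
      · have hw : 0 < a - 1 := by linarith
        have : (a - 1) * (a ^ 2 + b ^ 2 - d ^ 2) ≤ (a - 1) * (2 * (a * b) * K) := by
          have hq := mul_nonneg hw.le (mul_nonneg (sub_nonneg.2 hb) (sub_nonneg.2 hbR))
          have h1 := mul_le_mul_of_nonneg_left hRR (sub_nonneg.2 hb)
          have h2 := mul_le_mul_of_nonneg_left h1R (sub_nonneg.2 hbR)
          nlinarith
        exact le_of_mul_le_mul_left this hw
    · have hw : 0 < R - 1 := by linarith
      have hqa := mul_nonneg (sub_nonneg.2 ha) (sub_nonneg.2 haR)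
      have hqb := mul_nonneg (sub_nonneg.2 hb) (sub_nonneg.2 hbR)
      have hww := mul_pos hw hw
      have q : (R - 1) * (R - 1) * (a ^ 2 + b ^ 2 - d ^ 2)
          ≤ (R - 1) * (R - 1) * (2 * (a * b) * K) := by
        have g1 := mul_le_mul_of_nonneg_left h11
          (mul_nonneg (sub_nonneg.2 haR) (sub_nonneg.2 hbR))
        have g2 := mul_le_mul_of_nonneg_left h1R
          (mul_nonneg (sub_nonneg.2 ha) (sub_nonneg.2 hbR))
        have g3 := mul_le_mul_of_nonneg_left h1R
          (mul_nonneg (sub_nonneg.2 haR) (sub_nonneg.2 hb))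
        have g4 := mul_le_mul_of_nonneg_left hRR
          (mul_nonneg (sub_nonneg.2 ha) (sub_nonneg.2 hb))
        have k1 := mul_nonneg hww.le hqa
        have k2 := mul_nonneg hww.le hqb
        linear_combination g1 + g2 + g3 + g4 + k1 + k2
      exact le_of_mul_le_mul_left q hww
  nlinarith

theorem le_of_cos_le_cos {φ g : ℝ} (hg : 0 ≤ g) (hφ : φ ≤ Real.pi)
    (h : Real.cos g ≤ Real.cos φ) : φ ≤ g := by
  by_contra! hlt
  exact absurd h (not_le.2 (Real.cos_lt_cos_of_nonneg_of_le_pi hg hφ hlt))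

theorem EuclideanSpace.exists_polar (x : EuclideanSpace ℝ (Fin 2)) :
    ∃ θ ∈ Set.Ioc (-Real.pi) Real.pi,
      x 0 = ‖x‖ * Real.cos θ ∧ x 1 = ‖x‖ * Real.sin θ := by
  have hn : ‖x‖ = ‖(⟨x 0, x 1⟩ : ℂ)‖ := by
    rw [EuclideanSpace.norm_eq, Complex.norm_def, Complex.normSq_mk, Fin.sum_univ_two]
    simp [sq]
  refine ⟨Complex.arg ⟨x 0, x 1⟩, Complex.arg_mem_Ioc _, ?_, ?_⟩
  · rw [hn, Complex.norm_mul_cos_arg]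
  · rw [hn, Complex.norm_mul_sin_arg]

theorem EuclideanSpace.dist_sq_polar {x y : EuclideanSpace ℝ (Fin 2)} {s t : ℝ}
    (hx0 : x 0 = ‖x‖ * Real.cos s) (hx1 : x 1 = ‖x‖ * Real.sin s)
    (hy0 : y 0 = ‖y‖ * Real.cos t) (hy1 : y 1 = ‖y‖ * Real.sin t) :
    dist x y ^ 2 = ‖x‖ ^ 2 + ‖y‖ ^ 2 - 2 * ‖x‖ * ‖y‖ * Real.cos (t - s) := by
  rw [EuclideanSpace.dist_eq, Real.sq_sqrt (by positivity), Fin.sum_univ_two, Real.dist_eq,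
    Real.dist_eq, sq_abs, sq_abs, hx0, hx1, hy0, hy1, Real.cos_sub]
  linear_combination ‖x‖ ^ 2 * Real.sin_sq_add_cos_sq s + ‖y‖ ^ 2 * Real.sin_sq_add_cos_sq t

/-- If the angular gap between any two of eleven directions is at least `α` minus the defects of
the two directions, then going once around the circle bounds the total defect from below. -/
theorem eleven_mul_sub_two_mul_sum_le_two_pi {θ c : Fin 11 → ℝ} {α : ℝ}
    (hθ : ∀ i, θ i ∈ Set.Ioc (-Real.pi) Real.pi)
    (h : ∀ i j g, i ≠ j → 0 ≤ g → Real.cos g = Real.cos (θ j - θ i) → α - c i - c j ≤ g) :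
    11 * α - 2 * ∑ i, c i ≤ 2 * Real.pi := by
  set σ := Tuple.sort θ
  have hmono : Monotone (θ ∘ σ) := Tuple.monotone_sort θ
  have step (k : Fin 10) : α - c (σ k.castSucc) - c (σ k.succ)
      ≤ θ (σ k.succ) - θ (σ k.castSucc) := by
    refine h _ _ _ (fun e => ?_) (sub_nonneg.2 (hmono (Fin.castSucc_lt_succ).le)) rfl
    exact (Fin.castSucc_lt_succ (i := k)).ne (σ.injective e)
  have wrap : α - c (σ (Fin.last 10)) - c (σ 0)
      ≤ θ (σ 0) - θ (σ (Fin.last 10)) + 2 * Real.pi := by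
    refine h _ _ _ (fun e => ?_) ?_ (Real.cos_add_two_pi _)
    · exact absurd (σ.injective e) (by decide)
    · linarith [(hθ (σ 0)).1, (hθ (σ (Fin.last 10))).2]
  have total := Finset.sum_le_sum fun k (_ : k ∈ Finset.univ) => step k
  simp only [Finset.sum_sub_distrib] at total
  have s1 := Fin.sum_univ_castSucc fun k => c (σ k)
  have s2 := Fin.sum_univ_succ fun k => c (σ k)
  have t1 := Fin.sum_univ_castSucc fun k => θ (σ k)
  have t2 := Fin.sum_univ_succ fun k => θ (σ k)
  rw [Equiv.sum_comp σ c] at s1 s2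
  simp only [Finset.sum_const, Finset.card_univ, Fintype.card_fin, nsmul_eq_mul] at total
  push_cast at total
  linarith

theorem sum_ite_mem_zero_le {n m : ℕ} {S : Finset (Fin n)} {e : ℝ} (he : 0 ≤ e)
    (hS : n ≤ S.card + m) : ∑ i, (if i ∈ S then 0 else e) ≤ m * e := by
  have hc : Sᶜ.card ≤ m := by
    rw [Finset.card_compl, Fintype.card_fin]; omega
  calc ∑ i, (if i ∈ S then 0 else e) = ∑ i, (if i ∈ Sᶜ then e else 0) :=
        Finset.sum_congr rfl fun i _ => by by_cases hi : i ∈ S <;> simp [hi]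
    _ = Sᶜ.card * e := by
        rw [← Finset.sum_filter, Finset.sum_const, nsmul_eq_mul, Finset.filter_univ_mem]
    _ ≤ m * e := by gcongr

/-- Impossible: 11 points with pairwise distances ≥ q = 1/1.409, all in
1 ≤ ρ ≤ 1.45, at least 10 of them in 1 ≤ ρ ≤ 1.24 and at least 9 in 1 ≤ ρ ≤ 1.19. -/
theorem stmt_13 :
    ¬ ∃ X : Fin 11 → EuclideanSpace ℝ (Fin 2),
      Function.Injective X ∧
      (∀ i, (1 : ℝ) ≤ ‖X i‖ ∧ ‖X i‖ ≤ 1.45) ∧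
      (∃ S : Finset (Fin 11), 10 ≤ S.card ∧ ∀ i ∈ S, ‖X i‖ ≤ 1.24) ∧
      (∃ T : Finset (Fin 11), 9 ≤ T.card ∧ ∀ i ∈ T, ‖X i‖ ≤ 1.19) ∧
      (∀ i j, i ≠ j → (1 / 1.409 : ℝ) ≤ dist (X i) (X j)) := by
  rintro ⟨X, -, hX, ⟨S, hSc, hS⟩, ⟨T, hTc, hT⟩, hd⟩
  choose θ hθ h0 h1 using fun i => EuclideanSpace.exists_polar (X i)
  have cosα : (0.8224 : ℝ) ≤ Real.cos 0.6047 :=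
    le_trans (by norm_num)
      (Real.two_mul_sq_sub_one_iterate_le_cos _ (by rw [abs_of_pos] <;> norm_num))
  have cosβ : (0.8365 : ℝ) ≤ Real.cos 0.5794 :=
    le_trans (by norm_num)
      (Real.two_mul_sq_sub_one_iterate_le_cos _ (by rw [abs_of_pos] <;> norm_num))
  have cosγ : (0.8963 : ℝ) ≤ Real.cos 0.459 :=
    le_trans (by norm_num)
      (Real.two_mul_sq_sub_one_iterate_le_cos _ (by rw [abs_of_pos] <;> norm_num))
  have gap {R K φ : ℝ} (hφ : φ ≤ 3) (hK : K ≤ Real.cos φ)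
      (h11 : 2 - (1 / 1.409) ^ 2 ≤ 2 * K) (h1R : 1 + R ^ 2 - (1 / 1.409) ^ 2 ≤ 2 * R * K)
      (hRR : 2 * R ^ 2 - (1 / 1.409) ^ 2 ≤ 2 * R ^ 2 * K) (i j : Fin 11) (g : ℝ) (hij : i ≠ j)
      (hg : 0 ≤ g) (hcos : Real.cos g = Real.cos (θ j - θ i))
      (hi : ‖X i‖ ≤ R) (hj : ‖X j‖ ≤ R) : φ ≤ g := by
    have hdist : (1 / 1.409 : ℝ) ^ 2 ≤ dist (X i) (X j) ^ 2 := by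
      gcongr
      exact hd i j hij
    rw [EuclideanSpace.dist_sq_polar (h0 i) (h1 i) (h0 j) (h1 j), ← hcos] at hdist
    exact le_of_cos_le_cos hg (hφ.trans Real.pi_gt_three.le)
      ((cos_le_of_annulus (hX i).1 hi (hX j).1 hj hdist h11 h1R hRR).trans hK)
  have key := eleven_mul_sub_two_mul_sum_le_two_pi (α := 0.6047) hθ
    (c := fun i => (if i ∈ T then 0 else 0.6047 - 0.5794) + (if i ∈ S then 0 else 0.5794 - 0.459))
    (by
      intro i j g hij hg hcos
      have hT0 (k) : (0 : ℝ) ≤ if k ∈ T then 0 else 0.6047 - 0.5794 := by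
        split_ifs <;> norm_num
      have hS0 (k) : (0 : ℝ) ≤ if k ∈ S then 0 else 0.5794 - 0.459 := by
        split_ifs <;> norm_num
      have hT1 (k) (hk : 1.19 < ‖X k‖) :
          (if k ∈ T then 0 else 0.6047 - 0.5794 : ℝ) = 0.6047 - 0.5794 :=
        if_neg fun hm => (hT k hm).not_gt hk
      have hS1 (k) (hk : 1.24 < ‖X k‖) :
          (if k ∈ S then 0 else 0.5794 - 0.459 : ℝ) = 0.5794 - 0.459 :=
        if_neg fun hm => (hS k hm).not_gt hk
      have large (k) (hk : 1.24 < ‖X k‖) := hT1 k (lt_trans (by norm_num) hk)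
      have hTi := hT0 i
      have hTj := hT0 j
      have hSi := hS0 i
      have hSj := hS0 j
      by_cases small : ‖X i‖ ≤ 1.19 ∧ ‖X j‖ ≤ 1.19
      · have := gap (by norm_num) cosα (by norm_num) (by norm_num) (by norm_num)
          i j g hij hg hcos small.1 small.2
        linarith
      by_cases medium : ‖X i‖ ≤ 1.24 ∧ ‖X j‖ ≤ 1.24
      · have := gap (by norm_num) cosβ (by norm_num) (by norm_num) (by norm_num)
          i j g hij hg hcos medium.1 medium.2
        rcases not_and_or.1 small with hk | hk
        · linarith [hT1 i (not_le.1 hk)]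
        · linarith [hT1 j (not_le.1 hk)]
      · have := gap (by norm_num) cosγ (by norm_num) (by norm_num) (by norm_num)
          i j g hij hg hcos (hX i).2 (hX j).2
        rcases not_and_or.1 medium with hk | hk
        · linarith [hS1 i (not_le.1 hk), large i (not_le.1 hk)]
        · linarith [hS1 j (not_le.1 hk), large j (not_le.1 hk)])
  rw [Finset.sum_add_distrib] at key
  have sT := sum_ite_mem_zero_le (S := T) (m := 2) (e := 0.6047 - 0.5794) (by norm_num) (by omega)
  have sS := sum_ite_mem_zero_le (S := S) (m := 1) (e := 0.5794 - 0.459) (by norm_num) (by omega)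
  have := Real.pi_lt_d2
  norm_num at key sT sS this
  linarith
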